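/- Fix k ∈ ℕ and let a ∈ L²((0,1), r dr). Define the moments d_i = ∫₀¹ r^{2i+k−1} a(r) dr for integers i ≥ 1, and set p_n = ∑_{l=0}^{n} 2 (−1)^{n−l} (2n + k + 1) (∏_{j=0}^{n−1} (1 + k + l + j)) / (l! (n−l)!) · d_{l+1} for n ≥ 0. Then the series ∑_{n=0}^{∞} p_n L_n^k converges to a in L²((0,1), r dr), i.e. a(r) = ∑_{n=0}^{∞} p_n L_n^k(r) in the L²((0,1), r dr) sense. -/

import Mathlib

open MeasureTheory Finset Filter

/-- The Müntz–Legendre polynomial `L_n^k(x) = ∑_{l=0}^n c^k_{l,n} x^{2l+k}` with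
`c^k_{l,n} = (∏_{j<n} (l + j + k + 1)) / (∏_{j≤n, j≠l} (l - j))`, orthogonal with
respect to the weight `x dx` on `[0,1]`. -/
noncomputable def muntzLegendre (k n : ℕ) (x : ℝ) : ℝ :=
  ∑ l ∈ Finset.range (n + 1),
    ((∏ j ∈ Finset.range n, ((l : ℝ) + j + k + 1)) /
      (∏ j ∈ (Finset.range (n + 1)).erase l, ((l : ℝ) - j))) * x ^ (2 * l + k)

theorem ml_abstract {μ : Measure ℝ} (e : ℕ → ℝ → ℝ) (b : ℝ → ℝ)
    (he : ∀ n, MemLp (e n) 2 μ) (hb : MemLp b 2 μ)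
    (hon : ∀ m n, ∫ r, e m r * e n r ∂μ = if m = n then 1 else 0)
    (htot : ∀ f : ℝ → ℝ, MemLp f 2 μ → (∀ n, ∫ r, e n r * f r ∂μ = 0) → f =ᵐ[μ] 0) :
    Tendsto (fun N => ∫ r, ((∑ n ∈ range N, (∫ s, e n s * b s ∂μ) * e n r) - b r) ^ 2 ∂μ)
      atTop (nhds 0) := by
  have hinner : ∀ (f g : ℝ → ℝ) (hf : MemLp f 2 μ) (hg : MemLp g 2 μ),
      inner ℝ (hf.toLp f) (hg.toLp g) = ∫ r, f r * g r ∂μ := by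
    intro f g hf hg
    rw [L2.inner_def]
    apply integral_congr_ae
    filter_upwards [hf.coeFn_toLp, hg.coeFn_toLp] with r h1 h2
    rw [h1, h2]
    simp [mul_comm]
  let v : ℕ → Lp ℝ 2 μ := fun n => (he n).toLp (e n)
  have hv : Orthonormal ℝ v := by
    rw [orthonormal_iff_ite]
    intro m n
    rw [hinner, hon]
  have hsp : (Submodule.span ℝ (Set.range v))ᗮ = ⊥ := by
    rw [Submodule.eq_bot_iff]
    intro x hx
    rw [Submodule.mem_orthogonal] at hx
    have h0 : ∀ n, ∫ r, e n r * x r ∂μ = 0 := by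
      intro n
      have := hx (v n) (Submodule.subset_span ⟨n, rfl⟩)
      rw [← hinner _ _ (he n) (Lp.memLp x), Lp.toLp_coeFn]
      exact this
    have := htot x (Lp.memLp x) h0
    exact (Lp.eq_zero_iff_ae_eq_zero).2 this
  let B := HilbertBasis.mkOfOrthogonalEqBot hv hsp
  have hB : ∀ n, B n = v n := fun n => by
    simp [B]
  have hs := (B.hasSum_repr (hb.toLp b)).tendsto_sum_nat
  have hn : Tendsto (fun N => ‖(∑ n ∈ range N, B.repr (hb.toLp b) n • B n) - hb.toLp b‖ ^ 2)
      atTop (nhds 0) := by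
    have := (tendsto_iff_norm_sub_tendsto_zero.1 hs).pow 2
    simpa using this
  refine hn.congr fun N => ?_
  have hm : MemLp (fun r => (∑ n ∈ range N, (∫ s, e n s * b s ∂μ) * e n r) - b r) 2 μ := by
    refine MemLp.sub (memLp_finsetSum _ fun n _ => (he n).const_mul _) hb
  have hEq : (∑ n ∈ range N, B.repr (hb.toLp b) n • B n) - hb.toLp b = hm.toLp _ := by
    have h1 : ∀ n, B.repr (hb.toLp b) n • B n
        = ((he n).const_mul (∫ s, e n s * b s ∂μ)).toLp _ := by
      intro n
      rw [B.repr_apply_apply, hB, hinner]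
      rfl
    have h2 : ∀ N, ∑ n ∈ range N, B.repr (hb.toLp b) n • B n
      = (memLp_finsetSum (range N) fun n _ => (he n).const_mul (∫ s, e n s * b s ∂μ)).toLp _ := by
      intro N
      induction N with
      | zero => simp; rfl
      | succ N ih =>
        rw [Finset.sum_range_succ, ih, h1, ← MemLp.toLp_add]
        congr 1
        funext r
        simp [Finset.sum_range_succ]
    rw [h2, ← MemLp.toLp_sub]
    rfl
  rw [hEq, ← real_inner_self_eq_norm_sq, hinner]
  simp only [sq]

/-- coefficient -/
noncomputable def mlc (k n l : ℕ) : ℝ :=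
  (∏ j ∈ Finset.range n, ((l : ℝ) + j + k + 1)) /
      (∏ j ∈ (Finset.range (n + 1)).erase l, ((l : ℝ) - j))

theorem ml_pf (k n : ℕ) (t : ℝ) (ht : ∀ l ∈ range (n + 1), t ≠ (l : ℝ)) :
    ∑ l ∈ range (n + 1), mlc k n l * (t - l)⁻¹ =
      (∏ j ∈ range n, (t + j + k + 1)) / ∏ j ∈ range (n + 1), (t - j) := by
  have hne : (∏ j ∈ range (n + 1), (t - (j : ℝ))) ≠ 0 :=
    Finset.prod_ne_zero_iff.2 fun j hj => sub_ne_zero.2 (ht j hj)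
  let P : Polynomial ℝ := ∏ j ∈ range n, (Polynomial.X + Polynomial.C ((j : ℝ) + k + 1))
  have hP : ∀ x, P.eval x = ∏ j ∈ range n, (x + j + k + 1) := by
    intro x
    simp only [P, Polynomial.eval_prod, Polynomial.eval_add, Polynomial.eval_X, Polynomial.eval_C]
    exact Finset.prod_congr rfl fun j _ => by ring
  have hdeg : P.degree < #(range (n + 1)) := by
    have : P.degree = n := by
      simp only [P, Polynomial.degree_prod, Polynomial.degree_X_add_C]
      simp
    rw [this, card_range]
    exact_mod_cast Nat.lt_succ_self n
  have h1 := Lagrange.eq_interpolate (s := range (n + 1)) (v := fun j : ℕ => (j : ℝ))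
    (fun a _ b _ h => Nat.cast_injective h) hdeg
  have h2 := congrArg (Polynomial.eval t) h1
  rw [Lagrange.eval_interpolate_not_at_node _ ht, hP, Lagrange.eval_nodal] at h2
  rw [h2, mul_div_cancel_left₀ _ hne]
  refine Finset.sum_congr rfl fun l _ => ?_
  rw [hP, mlc, Lagrange.nodalWeight, Finset.prod_inv_distrib]
  ring

theorem ml_int_pow (m : ℕ) : ∫ r in Set.Ioo (0:ℝ) 1, r ^ m = ((m : ℝ) + 1)⁻¹ := by
  rw [← integral_Ioc_eq_integral_Ioo, ← intervalIntegral.integral_of_le zero_le_one, integral_pow]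
  simp

theorem ml_cont_int {f : ℝ → ℝ} (hf : Continuous f) :
    Integrable f (volume.restrict (Set.Ioo (0:ℝ) 1)) :=
  (hf.integrableOn_Icc (a := 0) (b := 1)).mono_set Set.Ioo_subset_Icc_self

theorem ml_eq (k n : ℕ) (r : ℝ) :
    muntzLegendre k n r = ∑ l ∈ range (n + 1), mlc k n l * r ^ (2 * l + k) := rfl

theorem ml_cont (k n : ℕ) : Continuous (muntzLegendre k n) := by
  unfold muntzLegendre
  fun_prop

theorem ml_moment (k n m : ℕ) :
    ∫ r in Set.Ioo (0:ℝ) 1, r ^ (2 * m + k) * muntzLegendre k n r * r =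
      -(1 / 2) * ((∏ j ∈ range n, ((j : ℝ) - m)) / ∏ j ∈ range (n + 1), (-((m : ℝ) + k + 1) - j)) := by
  have h1 : ∀ r : ℝ, r ^ (2 * m + k) * muntzLegendre k n r * r =
      ∑ l ∈ range (n + 1), mlc k n l * r ^ (2 * l + k + (2 * m + k) + 1) := by
    intro r
    rw [ml_eq, Finset.mul_sum, Finset.sum_mul]
    exact Finset.sum_congr rfl fun l _ => by ring
  simp_rw [h1]
  rw [integral_finsetSum _ fun l _ => ml_cont_int (by fun_prop)]
  simp_rw [integral_const_mul, ml_int_pow]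
  have h2 := ml_pf k n (-((m : ℝ) + k + 1)) (fun l _ h => by
    have : (0:ℝ) ≤ l := by positivity
    have : (0:ℝ) ≤ m := by positivity
    have : (0:ℝ) ≤ k := by positivity
    linarith)
  have h3 : (∏ j ∈ range n, ((j : ℝ) - m)) = ∏ j ∈ range n, (-((m : ℝ) + k + 1) + j + k + 1) :=
    Finset.prod_congr rfl fun j _ => by ring
  rw [h3, ← h2, Finset.mul_sum]
  refine Finset.sum_congr rfl fun l _ => ?_
  push_cast
  have : (l : ℝ) + m + k + 1 ≠ 0 := by positivity
  have e1 : (2 * (l : ℝ) + k + (2 * m + k) + 1 + 1) = 2 * (l + m + k + 1) := by ring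
  have e2 : (-((m : ℝ) + k + 1) - l) = - (l + m + k + 1) := by ring
  rw [e1, e2, inv_neg, mul_inv]
  ring

theorem ml_moment_zero (k n m : ℕ) (h : m < n) :
    ∫ r in Set.Ioo (0:ℝ) 1, r ^ (2 * m + k) * muntzLegendre k n r * r = 0 := by
  rw [ml_moment, Finset.prod_eq_zero (Finset.mem_range.2 h) (by simp)]
  simp

theorem mlc_denom (n l : ℕ) (h : l ≤ n) :
    (∏ j ∈ (Finset.range (n + 1)).erase l, ((l : ℝ) - j)) =
      (-1) ^ (n - l) * ((Nat.factorial l : ℝ) * (Nat.factorial (n - l) : ℝ)) := by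
  obtain ⟨q, rfl⟩ := Nat.exists_eq_add_of_le h
  rw [Nat.add_sub_cancel_left]
  have hd : (Finset.range (l + q + 1)).erase l
      = Finset.range l ∪ (Finset.range q).image (fun i => l + 1 + i) := by
    ext x
    simp only [mem_erase, mem_range, mem_union, mem_image]
    constructor
    · rintro ⟨h1, h2⟩
      rcases lt_or_gt_of_ne h1 with h | h
      · exact Or.inl h
      · exact Or.inr ⟨x - (l + 1), by omega, by omega⟩
    · rintro (h | ⟨a, h1, h2⟩) <;> omega
  rw [hd, Finset.prod_union, Finset.prod_image]
  · have e1 : ∏ x ∈ range l, ((l : ℝ) - x) = Nat.factorial l := by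
      rw [← Finset.prod_range_reflect, ← Finset.prod_range_add_one_eq_factorial]
      push_cast
      refine Finset.prod_congr rfl fun j hj => ?_
      have := Finset.mem_range.1 hj
      rw [Nat.sub_sub, Nat.cast_sub (by omega)]
      push_cast; ring
    have e2 : ∏ x ∈ range q, ((l : ℝ) - ((l + 1 + x : ℕ) : ℝ)) = (-1) ^ q * Nat.factorial q := by
      rw [← Finset.prod_range_add_one_eq_factorial]
      push_cast
      rw [← Finset.card_range q, ← Finset.prod_const, Finset.card_range, ← Finset.prod_mul_distrib]
      refine Finset.prod_congr rfl fun j hj => ?_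
      ring
    rw [e1, e2]; ring
  · intro a _ b _ h; simpa using h
  · rw [Finset.disjoint_left]
    intro x hx hx'
    simp only [mem_range, mem_image] at hx hx'
    obtain ⟨a, _, h⟩ := hx'
    omega

theorem mlc_diag (k n : ℕ) :
    mlc k n n = (∏ j ∈ range n, ((n : ℝ) + j + k + 1)) / Nat.factorial n := by
  rw [mlc, mlc_denom n n le_rfl]
  simp

theorem mlc_diag_pos (k n : ℕ) : 0 < mlc k n n := by
  rw [mlc_diag]
  have : 0 < ∏ j ∈ range n, ((n : ℝ) + j + k + 1) := Finset.prod_pos fun j _ => by positivity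
  positivity

theorem ml_moment_diag (k n : ℕ) :
    mlc k n n * ∫ r in Set.Ioo (0:ℝ) 1, r ^ (2 * n + k) * muntzLegendre k n r * r =
      1 / (2 * (2 * n + k + 1)) := by
  rw [ml_moment, mlc_diag]
  have e1 : ∏ j ∈ range n, ((j : ℝ) - n) = (-1) ^ n * Nat.factorial n := by
    have := mlc_denom n n le_rfl
    have h2 : (Finset.range (n + 1)).erase n = range n := by
      ext x; simp; omega
    rw [h2] at this
    simp at this
    rw [← this, ← Finset.card_range n, ← Finset.prod_const, Finset.card_range,
      ← Finset.prod_mul_distrib]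
    exact Finset.prod_congr rfl fun j _ => by ring
  have e2 : ∏ j ∈ range (n + 1), (-((n : ℝ) + k + 1) - j) =
      (-1) ^ (n + 1) * ((∏ j ∈ range n, ((n : ℝ) + j + k + 1)) * (2 * n + k + 1)) := by
    have : ∏ j ∈ range (n + 1), (-((n : ℝ) + k + 1) - j) =
      (∏ j ∈ range (n + 1), (-1 : ℝ)) * ∏ j ∈ range (n + 1), ((n : ℝ) + j + k + 1) := by
      rw [← Finset.prod_mul_distrib]
      exact Finset.prod_congr rfl fun j _ => by ring
    rw [this, Finset.prod_const, Finset.card_range, Finset.prod_range_succ _ n]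
    ring
  rw [e1, e2]
  have hp : ∏ j ∈ range n, ((n : ℝ) + j + k + 1) ≠ 0 :=
    Finset.prod_ne_zero_iff.2 fun j _ => by positivity
  have hf : (Nat.factorial n : ℝ) ≠ 0 := by positivity
  have hk : (2 * (n : ℝ) + k + 1) ≠ 0 := by positivity
  have hs : ((-1 : ℝ)) ^ n ≠ 0 := by positivity
  rw [pow_succ]
  field_simp

theorem ml_orth_le (k m n : ℕ) (h : m ≤ n) :
    ∫ r in Set.Ioo (0:ℝ) 1, muntzLegendre k m r * muntzLegendre k n r * r =
      if m = n then 1 / (2 * (2 * (n : ℝ) + k + 1)) else 0 := by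
  have h1 : ∀ r : ℝ, muntzLegendre k m r * muntzLegendre k n r * r =
      ∑ l ∈ range (m + 1), mlc k m l * (r ^ (2 * l + k) * muntzLegendre k n r * r) := by
    intro r
    rw [ml_eq k m, Finset.sum_mul, Finset.sum_mul]
    exact Finset.sum_congr rfl fun l _ => by ring
  simp_rw [h1]
  have hc := ml_cont k n
  rw [integral_finsetSum _ fun l _ => ml_cont_int (by fun_prop)]
  simp_rw [integral_const_mul]
  rw [Finset.sum_range_succ, Finset.sum_eq_zero, zero_add]
  · split_ifs with hmn
    · subst hmn; exact ml_moment_diag k m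
    · rw [ml_moment_zero _ _ _ (by omega), mul_zero]
  · intro l hl
    rw [ml_moment_zero _ _ _ (by have := mem_range.1 hl; omega), mul_zero]

theorem ml_orth (k m n : ℕ) :
    ∫ r in Set.Ioo (0:ℝ) 1, muntzLegendre k m r * muntzLegendre k n r * r =
      if m = n then 1 / (2 * (2 * (n : ℝ) + k + 1)) else 0 := by
  rcases le_total m n with h | h
  · exact ml_orth_le k m n h
  · have := ml_orth_le k n m h
    simp_rw [mul_comm (muntzLegendre k m _) (muntzLegendre k n _)]
    rw [this]
    by_cases hmn : m = n
    · subst hmn; simp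
    · rw [if_neg hmn, if_neg (Ne.symm hmn)]

theorem ml_cont_memLp {f : ℝ → ℝ} (hf : Continuous f) :
    MemLp f 2 (volume.restrict (Set.Ioo (0:ℝ) 1)) := by
  rw [memLp_two_iff_integrable_sq hf.aestronglyMeasurable]
  exact ml_cont_int (by fun_prop)

theorem ml_mul_int {f g : ℝ → ℝ} (hf : Continuous f)
    (hg : MemLp g 2 (volume.restrict (Set.Ioo (0:ℝ) 1))) :
    Integrable (fun r => f r * g r) (volume.restrict (Set.Ioo (0:ℝ) 1)) :=
  MemLp.integrable_mul (ml_cont_memLp hf) hg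

/-- a function with vanishing even moments vanishes -/
theorem ml_even_moments (g : ℝ → ℝ) (hg : MemLp g 2 (volume.restrict (Set.Ioo (0:ℝ) 1)))
    (h : ∀ l : ℕ, ∫ r in Set.Ioo (0:ℝ) 1, r ^ (2 * l) * g r = 0) :
    g =ᵐ[volume.restrict (Set.Ioo (0:ℝ) 1)] 0 := by
  have hgi : Integrable g (volume.restrict (Set.Ioo (0:ℝ) 1)) := hg.integrable one_le_two
  have hpoly : ∀ q : Polynomial ℝ, ∫ r in Set.Ioo (0:ℝ) 1, q.eval (r ^ 2) * g r = 0 := by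
    intro q
    have : ∀ r : ℝ, q.eval (r ^ 2) * g r
        = ∑ i ∈ range (q.natDegree + 1), q.coeff i * (r ^ (2 * i) * g r) := by
      intro r
      rw [Polynomial.eval_eq_sum_range, Finset.sum_mul]
      exact Finset.sum_congr rfl fun i _ => by rw [← pow_mul]; ring
    simp_rw [this]
    rw [integral_finsetSum _ fun i _ => (ml_mul_int (by fun_prop) hg).const_mul _]
    simp_rw [integral_const_mul, h]
    simp
  have hcont : ∀ φ : ℝ → ℝ, Continuous φ → ∫ r in Set.Ioo (0:ℝ) 1, φ r * g r = 0 := by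
    intro φ hφ
    set K := ∫ r in Set.Ioo (0:ℝ) 1, |g r| with hK
    have hK0 : 0 ≤ K := integral_nonneg fun r => abs_nonneg _
    have hb : ∀ ε > 0, |∫ r in Set.Ioo (0:ℝ) 1, φ r * g r| ≤ ε * K := by
      intro ε hε
      obtain ⟨q, hq⟩ := exists_polynomial_near_of_continuousOn 0 1 (fun y => φ (√y))
        (by fun_prop) ε hε
      have e1 : ∫ r in Set.Ioo (0:ℝ) 1, φ r * g r
          = ∫ r in Set.Ioo (0:ℝ) 1, (φ r - q.eval (r ^ 2)) * g r := by
        simp_rw [sub_mul]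
        rw [integral_sub (ml_mul_int hφ hg) (ml_mul_int (by fun_prop) hg), hpoly, sub_zero]
      rw [e1, hK, ← integral_const_mul]
      refine (abs_integral_le_integral_abs).trans ?_
      refine integral_mono_ae (ml_mul_int (by fun_prop) hg).abs (hgi.abs.const_mul _) ?_
      filter_upwards [ae_restrict_mem measurableSet_Ioo] with r hr
      simp only [abs_mul]
      refine mul_le_mul_of_nonneg_right ?_ (abs_nonneg _)
      have := hq (r ^ 2) ⟨by positivity, by nlinarith [hr.1, hr.2]⟩
      simp only [Real.sqrt_sq hr.1.le] at this
      rw [abs_sub_comm]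
      exact this.le
    by_contra hne
    have hpos := abs_pos.2 hne
    have := hb (|∫ r in Set.Ioo (0:ℝ) 1, φ r * g r| / (2 * (K + 1))) (by positivity)
    rw [div_mul_eq_mul_div, le_div_iff₀ (by positivity)] at this
    nlinarith
  have := isOpen_Ioo.ae_eq_zero_of_integral_contDiff_smul_eq_zero (μ := volume) (f := g)
    (U := Set.Ioo (0:ℝ) 1) (IntegrableOn.locallyIntegrableOn hgi) (by
      intro φ hφ _ hs
      rw [← hcont φ hφ.continuous]
      symm
      apply setIntegral_eq_integral_of_forall_compl_eq_zero
      intro x hx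
      have : φ x = 0 := by
        by_contra h0
        exact hx (hs (subset_tsupport _ h0))
      simp [this])
  rw [Filter.EventuallyEq, ae_restrict_iff' measurableSet_Ioo]
  exact this

/-- normalized functions -/
noncomputable def mle (k n : ℕ) (r : ℝ) : ℝ :=
  √(2 * (2 * (n : ℝ) + k + 1)) * muntzLegendre k n r * √r

theorem mle_cont (k n : ℕ) : Continuous (mle k n) := by
  have := ml_cont k n
  unfold mle
  fun_prop

theorem mle_total (k : ℕ) (f : ℝ → ℝ) (hf : MemLp f 2 (volume.restrict (Set.Ioo (0:ℝ) 1)))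
    (h : ∀ n, ∫ r in Set.Ioo (0:ℝ) 1, mle k n r * f r = 0) :
    f =ᵐ[volume.restrict (Set.Ioo (0:ℝ) 1)] 0 := by
  have hint : ∀ l : ℕ, Integrable (fun r => r ^ (2 * l + k) * √r * f r)
      (volume.restrict (Set.Ioo (0:ℝ) 1)) := fun l => ml_mul_int (by fun_prop) hf
  have hL : ∀ n, ∑ l ∈ range (n + 1),
      mlc k n l * ∫ r in Set.Ioo (0:ℝ) 1, r ^ (2 * l + k) * √r * f r = 0 := by
    intro n
    simp_rw [← integral_const_mul]
    rw [← integral_finsetSum _ fun l _ => (hint l).const_mul _]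
    have hn := h n
    have e : ∀ r, mle k n r * f r = √(2 * (2 * (n : ℝ) + k + 1)) *
        ∑ l ∈ range (n + 1), mlc k n l * (r ^ (2 * l + k) * √r * f r) := by
      intro r
      rw [mle, ml_eq, mul_assoc, mul_assoc, Finset.sum_mul]
      congr 1
      exact Finset.sum_congr rfl fun l _ => by ring
    simp_rw [e] at hn
    rw [integral_const_mul] at hn
    exact (mul_eq_zero.1 hn).resolve_left (by positivity)
  have hm : ∀ l : ℕ, ∫ r in Set.Ioo (0:ℝ) 1, r ^ (2 * l + k) * √r * f r = 0 := by
    intro l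
    induction l using Nat.strong_induction_on with
    | _ n ih =>
      have := hL n
      rw [Finset.sum_range_succ, Finset.sum_eq_zero, zero_add] at this
      · exact (mul_eq_zero.1 this).resolve_left (mlc_diag_pos k n).ne'
      · intro l hl
        rw [ih l (mem_range.1 hl), mul_zero]
  have hG : MemLp (fun r => r ^ k * √r * f r) 2 (volume.restrict (Set.Ioo (0:ℝ) 1)) := by
    refine hf.of_le (AEStronglyMeasurable.mul (by fun_prop) hf.1) ?_
    filter_upwards [ae_restrict_mem measurableSet_Ioo] with r hr
    rw [norm_mul]
    refine mul_le_of_le_one_left (norm_nonneg _) ?_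
    rw [Real.norm_of_nonneg (mul_nonneg (pow_nonneg hr.1.le _) (Real.sqrt_nonneg _))]
    exact mul_le_one₀ (pow_le_one₀ hr.1.le hr.2.le) (Real.sqrt_nonneg _)
      (Real.sqrt_le_one.2 hr.2.le)
  have h0 := ml_even_moments _ hG (fun l => by
    refine Eq.trans ?_ (hm l)
    congr 1
    funext r
    ring)
  filter_upwards [h0, ae_restrict_mem measurableSet_Ioo] with r hr hr1
  have hr0 := hr1.1
  have : r ^ k * √r ≠ 0 := by positivity
  exact (mul_eq_zero.1 hr).resolve_left this

/-- inversion of the moment problem. For `a ∈ L²((0,1), r dr)` with moments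
`d_i = ∫₀¹ r^{2i+k-1} a(r) dr` and coefficients
`p_n = ∑_{l=0}^n 2 (-1)^{n-l} (2n+k+1) (∏_{j<n}(1+k+l+j)) / (l!(n-l)!) d_{l+1}`,
the series `∑ p_n L_n^k` converges to `a` in `L²((0,1), r dr)`. -/
theorem muntz_legendre_expansion_converges (k : ℕ) (a : ℝ → ℝ)
    (hmeas : AEMeasurable a (volume.restrict (Set.Ioo (0:ℝ) 1)))
    (hL2 : IntegrableOn (fun r => a r ^ 2 * r) (Set.Ioo (0:ℝ) 1))
    (d : ℕ → ℝ)
    (hd : ∀ i, d i = ∫ r in Set.Ioo (0:ℝ) 1, r ^ (2 * i + k - 1) * a r)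
    (p : ℕ → ℝ)
    (hp : ∀ n, p n = ∑ l ∈ Finset.range (n + 1),
      2 * (-1 : ℝ) ^ (n - l) * (2 * n + k + 1) *
        (∏ j ∈ Finset.range n, (1 + (k : ℝ) + l + j)) /
        ((Nat.factorial l : ℝ) * (Nat.factorial (n - l) : ℝ)) * d (l + 1)) :
    Filter.Tendsto
      (fun N => ∫ r in Set.Ioo (0:ℝ) 1,
        ((∑ n ∈ Finset.range N, p n * muntzLegendre k n r) - a r) ^ 2 * r)
      Filter.atTop (nhds 0) := by
  have hb : MemLp (fun r => a r * √r) 2 (volume.restrict (Set.Ioo (0:ℝ) 1)) := by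
    have hm : AEMeasurable (fun r => a r * √r) (volume.restrict (Set.Ioo (0:ℝ) 1)) :=
      hmeas.mul (by fun_prop)
    rw [memLp_two_iff_integrable_sq hm.aestronglyMeasurable]
    refine hL2.congr ?_
    filter_upwards [ae_restrict_mem measurableSet_Ioo] with r hr
    rw [mul_pow, Real.sq_sqrt hr.1.le]
  have key := ml_abstract (mle k) (fun r => a r * √r) (fun n => ml_cont_memLp (mle_cont k n)) hb
    (by
      intro m n
      have e : ∀ r ∈ Set.Ioo (0:ℝ) 1, mle k m r * mle k n r =
          √(2 * (2 * (m : ℝ) + k + 1)) * √(2 * (2 * (n : ℝ) + k + 1)) *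
            (muntzLegendre k m r * muntzLegendre k n r * r) := by
        intro r hr
        have := Real.mul_self_sqrt hr.1.le
        rw [mle, mle]
        linear_combination √(2 * (2 * (m : ℝ) + k + 1)) * √(2 * (2 * (n : ℝ) + k + 1)) *
            (muntzLegendre k m r * muntzLegendre k n r) * this
      rw [setIntegral_congr_fun measurableSet_Ioo e, integral_const_mul, ml_orth]
      split_ifs with hmn
      · subst hmn
        rw [Real.mul_self_sqrt (by positivity)]
        field_simp
      · simp)
    (mle_total k)
  have hcoef : ∀ n, p n = √(2 * (2 * (n : ℝ) + k + 1)) *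
      ∫ s in Set.Ioo (0:ℝ) 1, mle k n s * (a s * √s) := by
    intro n
    have e : ∀ s, mle k n s * (a s * √s) = √(2 * (2 * (n : ℝ) + k + 1)) *
        ∑ l ∈ range (n + 1), mlc k n l * (s ^ (2 * l + k) * √s * (a s * √s)) := by
      intro s
      rw [mle, ml_eq, mul_assoc, mul_assoc, Finset.sum_mul]
      congr 1
      exact Finset.sum_congr rfl fun l _ => by ring
    simp_rw [e]
    rw [integral_const_mul, ← mul_assoc, Real.mul_self_sqrt (by positivity),
      integral_finsetSum _ fun l _ => (ml_mul_int (by fun_prop) hb).const_mul _, hp,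
      Finset.mul_sum]
    refine Finset.sum_congr rfl fun l hl => ?_
    have hl' : l ≤ n := Nat.lt_succ_iff.1 (mem_range.1 hl)
    have ed : d (l + 1) = ∫ s in Set.Ioo (0:ℝ) 1, s ^ (2 * l + k) * √s * (a s * √s) := by
      rw [hd]
      refine setIntegral_congr_fun measurableSet_Ioo fun s hs => ?_
      have h1 : 2 * (l + 1) + k - 1 = 2 * l + k + 1 := by omega
      have := Real.mul_self_sqrt hs.1.le
      simp only [h1]
      linear_combination (-(s ^ (2 * l + k) * a s)) * this
    rw [integral_const_mul, ← ed, mlc, mlc_denom n l hl']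
    have e3 : ∏ j ∈ range n, ((l : ℝ) + j + k + 1) = ∏ j ∈ range n, (1 + (k : ℝ) + l + j) :=
      Finset.prod_congr rfl fun j _ => by ring
    rw [e3]
    have hs : ((-1 : ℝ) ^ (n - l)) * (-1) ^ (n - l) = 1 := by
      rw [← mul_pow]; simp
    have hs0 : ((-1 : ℝ) ^ (n - l)) ≠ 0 := by positivity
    have hi : ((-1 : ℝ) ^ (n - l))⁻¹ = (-1) ^ (n - l) := by
      rw [inv_eq_iff_eq_inv]; exact eq_inv_of_mul_eq_one_left hs
    rw [div_eq_mul_inv, div_eq_mul_inv, mul_inv ((-1 : ℝ) ^ (n - l)), hi]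
    ring
  refine key.congr fun N => ?_
  refine setIntegral_congr_fun measurableSet_Ioo fun r hr => ?_
  have hsum : ∑ n ∈ range N, (∫ s in Set.Ioo (0:ℝ) 1, mle k n s * (a s * √s)) * mle k n r
      = (∑ n ∈ range N, p n * muntzLegendre k n r) * √r := by
    rw [Finset.sum_mul]
    refine Finset.sum_congr rfl fun n _ => ?_
    rw [hcoef n, mle]
    ring
  simp only [hsum]
  rw [← sub_mul, mul_pow, Real.sq_sqrt hr.1.le]
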